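/- arXiv:2111.04596 — 5 statements merged into one kernel-verified Lean document; each statement's English description precedes it below -/
import Mathlib

section
/- Let J : ℝ^P → ℝ be twice continuously differentiable, lower bounded, with L-Lipschitz continuous gradient, let α > 0, β > 0, and let 0 < γ < min(2α/((1 + αβ)L + α²), 1/α + β, 2β). Let (θ_k, ψ_k)_{k∈ℕ} be the INNA iterates from any initialization (θ₀, ψ₀), and define E_k = (1 + αβ − γα)J(θ_k) + (1/2)‖(α − 1/β)θ_k + (1/β)ψ_k‖². Then the sequence (E_k)_{k∈ℕ} is decreasing and converges, and there exist constants C₁ > 0 and C₂ > 0 such that for all K ∈ ℕ, C₁ ∑_{k=0}^{K} ‖θ_{k+1} − θ_k‖² + C₂ ∑_{k=0}^{K} ‖∇J(θ_k)‖² ≤ E₀ − E_{K+1} < +∞. -/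
open Filter Topology

/-- The descent lemma: a differentiable function with `L`-Lipschitz gradient lies below its
quadratic upper model. -/
theorem le_add_inner_add_of_lipschitzWith_gradient {F : Type*} [NormedAddCommGroup F]
    [InnerProductSpace ℝ F] [CompleteSpace F] {f : F → ℝ} {L : NNReal}
    (hf : Differentiable ℝ f) (hlip : LipschitzWith L (gradient f)) (x d : F) :
    f (x + d) ≤ f x + inner ℝ (gradient f x) d + L / 2 * ‖d‖ ^ 2 := by
  let φ : ℝ → ℝ := fun t => f (x + t • d) - t * inner ℝ (gradient f x) d
    - L / 2 * ‖d‖ ^ 2 * t ^ 2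
  have hφ : ∀ t, HasDerivAt φ (inner ℝ (gradient f (x + t • d)) d
      - 1 * inner ℝ (gradient f x) d - L / 2 * ‖d‖ ^ 2 * (2 * t)) t := by
    intro t
    have h1 : HasDerivAt (fun t : ℝ => x + t • d) d t := by
      simpa using ((hasDerivAt_id t).smul_const d).const_add x
    have h2 : HasDerivAt (fun t : ℝ => f (x + t • d)) (inner ℝ (gradient f (x + t • d)) d) t := by
      simpa [Function.comp_def]
        using (hf (x + t • d)).hasGradientAt.hasFDerivAt.comp_hasDerivAt t h1
    have h3 : HasDerivAt (fun t : ℝ => L / 2 * ‖d‖ ^ 2 * t ^ 2)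
        (L / 2 * ‖d‖ ^ 2 * (2 * t)) t := by
      simpa using (hasDerivAt_pow 2 t).const_mul (L / 2 * ‖d‖ ^ 2)
    exact (h2.sub ((hasDerivAt_id t).mul_const _)).sub h3
  have hanti : AntitoneOn φ (Set.Icc 0 1) := by
    refine antitoneOn_of_deriv_nonpos (convex_Icc 0 1)
      (fun t _ => (hφ t).continuousAt.continuousWithinAt)
      (fun t _ => (hφ t).differentiableAt.differentiableWithinAt) fun t ht => ?_
    rw [interior_Icc] at ht
    rw [(hφ t).deriv]
    have h1 : ‖gradient f (x + t • d) - gradient f x‖ ≤ L * (t * ‖d‖) := by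
      simpa [norm_smul, abs_of_pos ht.1] using hlip.norm_sub_le (x + t • d) x
    have h2 := real_inner_le_norm (gradient f (x + t • d) - gradient f x) d
    rw [inner_sub_left] at h2
    have h3 := mul_le_mul_of_nonneg_right h1 (norm_nonneg d)
    linarith
  have h := hanti (Set.left_mem_Icc.2 zero_le_one) (Set.right_mem_Icc.2 zero_le_one) zero_le_one
  simp only [φ, one_smul, zero_smul, add_zero] at h
  linarith

/-- With step `d = γ • (-u - β • g)`, moving `u` to `u + α • d + γ • g` changes the kinetic energy
by an explicit quadratic form in `d` and `g`. -/
theorem half_norm_sq_add_smul_add_smul {F : Type*} [NormedAddCommGroup F]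
    [InnerProductSpace ℝ F] {α β γ : ℝ} (hγ : γ ≠ 0) {u g d : F}
    (hd : d = γ • (-u - β • g)) :
    1 / 2 * ‖u + α • d + γ • g‖ ^ 2 = 1 / 2 * ‖u‖ ^ 2
      - (1 + α * β - γ * α) * inner ℝ g d - (α / γ - α ^ 2 / 2) * ‖d‖ ^ 2
      - γ * (β - γ / 2) * ‖g‖ ^ 2 := by
  have hu : u = -((1 / γ) • d) - β • g := by
    rw [hd, smul_smul, one_div_mul_cancel hγ]
    module
  have hinner : inner ℝ u (α • d + γ • g) = -(α / γ) * ‖d‖ ^ 2 - (1 + α * β) * inner ℝ g d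
      - β * γ * ‖g‖ ^ 2 := by
    rw [hu]
    simp only [inner_sub_left, inner_neg_left, inner_add_right, real_inner_smul_left,
      real_inner_smul_right, real_inner_self_eq_norm_sq, real_inner_comm g d]
    field_simp
    ring
  have hw : ‖α • d + γ • g‖ ^ 2 = α ^ 2 * ‖d‖ ^ 2 + 2 * α * γ * inner ℝ g d
      + γ ^ 2 * ‖g‖ ^ 2 := by
    rw [norm_add_sq_real, norm_smul, norm_smul, real_inner_smul_left, real_inner_smul_right,
      mul_pow, mul_pow, Real.norm_eq_abs, Real.norm_eq_abs, sq_abs, sq_abs, real_inner_comm]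
    ring
  rw [add_assoc, norm_add_sq_real, hinner, hw]
  ring

/-- Lemma 4 of the paper, Lyapunov decrease for INNA.
Let `J : ℝ^P → ℝ` be twice continuously differentiable, lower bounded, with
`L`-Lipschitz gradient, `α > 0`, `β > 0`,
`0 < γ < min (2α/((1 + αβ)L + α²)) (1/α + β) (2β)`, and let `(θ_k, ψ_k)` be INNA
iterates.  Define `E_k = (1 + αβ − γα)J(θ_k) + (1/2)‖(α − 1/β)θ_k + (1/β)ψ_k‖²`.
Then `(E_k)` is decreasing and converges, and there exist `C₁ > 0`, `C₂ > 0` such that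
for all `K`, `C₁ ∑_{k=0}^{K} ‖θ_{k+1} − θ_k‖² + C₂ ∑_{k=0}^{K} ‖∇J(θ_k)‖² ≤ E₀ − E_{K+1}`. -/
theorem inna_lyapunov (P : ℕ) (J : EuclideanSpace ℝ (Fin P) → ℝ)
    (hJ : ContDiff ℝ 2 J) (hbdd : BddBelow (Set.range J))
    (L : ℝ) (hL : 0 < L) (hlip : LipschitzWith (Real.toNNReal L) (gradient J))
    (α β γ : ℝ) (hα : 0 < α) (hβ : 0 < β) (hγ : 0 < γ)
    (hγ' : γ < min (2 * α / ((1 + α * β) * L + α ^ 2)) (min (1 / α + β) (2 * β)))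
    (θ ψ : ℕ → EuclideanSpace ℝ (Fin P))
    (hθ : ∀ k, θ (k + 1) =
      θ k + γ • (-(α - 1 / β) • θ k - (1 / β) • ψ k - β • gradient J (θ k)))
    (hψ : ∀ k, ψ (k + 1) = ψ k + γ • (-(α - 1 / β) • θ k - (1 / β) • ψ k))
    (E : ℕ → ℝ)
    (hE : ∀ k, E k = (1 + α * β - γ * α) * J (θ k)
      + (1 / 2) * ‖(α - 1 / β) • θ k + (1 / β) • ψ k‖ ^ 2) :
    Antitone E ∧ (∃ c : ℝ, Tendsto E atTop (𝓝 c)) ∧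
    ∃ C₁ > (0 : ℝ), ∃ C₂ > (0 : ℝ), ∀ K : ℕ,
      C₁ * ∑ k ∈ Finset.range (K + 1), ‖θ (k + 1) - θ k‖ ^ 2
        + C₂ * ∑ k ∈ Finset.range (K + 1), ‖gradient J (θ k)‖ ^ 2
      ≤ E 0 - E (K + 1) := by
  obtain ⟨hγ1, hγ2, hγ3⟩ : γ < 2 * α / ((1 + α * β) * L + α ^ 2) ∧ γ < 1 / α + β ∧ γ < 2 * β := by
    simpa only [lt_min_iff] using hγ'
  have hc : 0 < 1 + α * β - γ * α := by
    have h := mul_lt_mul_of_pos_right hγ2 hα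
    rw [add_mul, one_div_mul_cancel hα.ne'] at h
    linarith
  have hC₁ : 0 < α / γ - α ^ 2 / 2 - (1 + α * β - γ * α) * L / 2 := by
    rw [lt_div_iff₀ (by positivity)] at hγ1
    have h : ((1 + α * β) * L + α ^ 2) / 2 < α / γ := by
      rw [lt_div_iff₀ hγ]
      linarith
    have : 0 < γ * α * L := by positivity
    linarith
  have hC₂ : 0 < γ * (β - γ / 2) := mul_pos hγ (by linarith)
  have hdiff : Differentiable ℝ J := hJ.differentiable (by norm_num)
  have hstep : ∀ k, (α / γ - α ^ 2 / 2 - (1 + α * β - γ * α) * L / 2) * ‖θ (k + 1) - θ k‖ ^ 2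
      + γ * (β - γ / 2) * ‖gradient J (θ k)‖ ^ 2 ≤ E k - E (k + 1) := by
    intro k
    have hd : θ (k + 1) - θ k = γ • (-((α - 1 / β) • θ k + (1 / β) • ψ k)
        - β • gradient J (θ k)) := by
      rw [hθ]
      module
    have hu : (α - 1 / β) • θ (k + 1) + (1 / β) • ψ (k + 1)
        = ((α - 1 / β) • θ k + (1 / β) • ψ k) + α • (θ (k + 1) - θ k)
          + γ • gradient J (θ k) := by
      rw [hθ, hψ]
      match_scalars <;> field_simp <;> ring
    have hdescent := le_add_inner_add_of_lipschitzWith_gradient hdiff hlip (θ k) (θ (k + 1) - θ k)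
    rw [add_sub_cancel, Real.coe_toNNReal L hL.le] at hdescent
    have h := mul_le_mul_of_nonneg_left hdescent hc.le
    rw [hE k, hE (k + 1), hu, half_norm_sq_add_smul_add_smul hγ.ne' hd]
    linarith
  have hanti : Antitone E := antitone_nat_of_succ_le fun k => by
    have h := hstep k
    have h1 := mul_nonneg hC₁.le (sq_nonneg ‖θ (k + 1) - θ k‖)
    have h2 := mul_nonneg hC₂.le (sq_nonneg ‖gradient J (θ k)‖)
    linarith
  obtain ⟨m, hm⟩ := hbdd
  have hEbdd : BddBelow (Set.range E) := by
    refine ⟨(1 + α * β - γ * α) * m, ?_⟩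
    rintro _ ⟨k, rfl⟩
    rw [hE]
    have h := mul_le_mul_of_nonneg_left (hm ⟨θ k, rfl⟩) hc.le
    have := sq_nonneg ‖(α - 1 / β) • θ k + (1 / β) • ψ k‖
    linarith
  refine ⟨hanti, ⟨_, tendsto_atTop_ciInf hanti hEbdd⟩, _, hC₁, _, hC₂, fun K => ?_⟩
  rw [Finset.mul_sum, Finset.mul_sum, ← Finset.sum_add_distrib, ← Finset.sum_range_sub']
  exact Finset.sum_le_sum fun k _ => hstep k
end

section
/- Let H ∈ ℝ^{P×P} be a symmetric matrix with eigenvalues λ₁, …, λ_P (listed with multiplicity), and let α ≥ 0, β > 0, γ > 0. Then the 2P × 2P block matrix M = [[(1 − γ(α − 1/β))I_P − γβH, −(γ/β)I_P], [−γ(α − 1/β)I_P, (1 − γ/β)I_P]] has characteristic polynomial equal to ∏_{p=1}^P (X² − (2 − γ(α + βλ_p))X + 1 − γ(α + βλ_p) + γ²λ_p). -/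
open Polynomial

section

variable {n K : Type*} [Fintype n] [DecidableEq n] [Field K]

/-- The determinant of an affine function of a matrix whose characteristic polynomial splits. -/
theorem Matrix.det_smul_one_add_smul_of_charpoly_eq_prod {H : Matrix n n K} {l : n → K}
    (hl : H.charpoly = ∏ p, (X - C (l p))) (u v : K) :
    (u • (1 : Matrix n n K) + v • H).det = ∏ p, (u + v * l p) := by
  rcases eq_or_ne v 0 with rfl | hv
  · simp
  have hdet : (Matrix.scalar n (-u / v) - H).det = ∏ p, (-u / v - l p) := by
    rw [← Matrix.eval_charpoly, hl, eval_prod]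
    simp
  have hmat : u • (1 : Matrix n n K) + v • H = (-v) • (Matrix.scalar n (-u / v) - H) := by
    rw [Matrix.scalar_apply, ← Matrix.smul_one_eq_diagonal, smul_sub, smul_smul, neg_smul,
      sub_neg_eq_add]
    congr 2
    field_simp
  rw [hmat, Matrix.det_smul, hdet, ← Finset.card_univ, ← Finset.prod_const,
    ← Finset.prod_mul_distrib]
  refine Finset.prod_congr rfl fun p _ => ?_
  field_simp
  ring

/-- The determinant of a block matrix whose blocks are scalar except for the first, which is
an affine function of a matrix whose characteristic polynomial splits. -/
theorem Matrix.det_fromBlocks_smul_one_of_charpoly_eq_prod {H : Matrix n n K} {l : n → K}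
    (hl : H.charpoly = ∏ p, (X - C (l p))) (a h b c : K) {d : K} (hd : d ≠ 0) :
    (Matrix.fromBlocks (a • (1 : Matrix n n K) + h • H) (b • (1 : Matrix n n K))
      (c • (1 : Matrix n n K)) (d • (1 : Matrix n n K))).det =
      ∏ p, ((a + h * l p) * d - b * c) := by
  have hmul : Matrix.fromBlocks (a • (1 : Matrix n n K) + h • H) (b • (1 : Matrix n n K))
      (c • (1 : Matrix n n K)) (d • (1 : Matrix n n K)) *
      Matrix.fromBlocks 1 0 ((-(c / d)) • (1 : Matrix n n K)) 1 =
      Matrix.fromBlocks ((a - b * c / d) • (1 : Matrix n n K) + h • H) (b • (1 : Matrix n n K)) 0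
        (d • (1 : Matrix n n K)) := by
    rw [Matrix.fromBlocks_multiply]
    congr 1
    · simp only [mul_one, smul_mul_smul_comm]
      module
    · simp
    · simp only [mul_one, smul_mul_smul_comm, ← add_smul]
      rw [mul_neg, mul_div_cancel₀ _ hd, add_neg_cancel, zero_smul]
    · simp
  have hdet := congrArg Matrix.det hmul
  rw [Matrix.det_mul, Matrix.det_fromBlocks_zero₁₂, Matrix.det_one, mul_one, mul_one,
    Matrix.det_fromBlocks_zero₂₁, Matrix.det_smul_one_add_smul_of_charpoly_eq_prod hl,
    Matrix.det_smul, Matrix.det_one, mul_one, ← Finset.card_univ, ← Finset.prod_const,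
    ← Finset.prod_mul_distrib] at hdet
  rw [hdet]
  refine Finset.prod_congr rfl fun p _ => ?_
  field_simp
  ring

/-- The characteristic polynomial of a block matrix whose blocks are scalar except for the first,
which is an affine function of a matrix whose characteristic polynomial splits. -/
theorem Matrix.charpoly_fromBlocks_smul_one_of_charpoly_eq_prod [Infinite K]
    {H : Matrix n n K} {l : n → K} (hl : H.charpoly = ∏ p, (X - C (l p))) (a h b c d : K) :
    (Matrix.fromBlocks (a • (1 : Matrix n n K) + h • H) (b • (1 : Matrix n n K))
      (c • (1 : Matrix n n K)) (d • (1 : Matrix n n K))).charpoly =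
      ∏ p, (X ^ 2 - C (a + h * l p + d) * X + C ((a + h * l p) * d - b * c)) := by
  refine eq_of_infinite_eval_eq _ _ ((Set.finite_singleton d).infinite_compl.mono fun x hx => ?_)
  have hxd : x - d ≠ 0 := sub_ne_zero.mpr hx
  have hmat : Matrix.scalar (n ⊕ n) x -
      Matrix.fromBlocks (a • (1 : Matrix n n K) + h • H) (b • (1 : Matrix n n K))
      (c • (1 : Matrix n n K)) (d • (1 : Matrix n n K)) =
      Matrix.fromBlocks ((x - a) • (1 : Matrix n n K) + (-h) • H) ((-b) • (1 : Matrix n n K))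
        ((-c) • (1 : Matrix n n K))
        ((x - d) • (1 : Matrix n n K)) := by
    rw [Matrix.scalar_apply, ← Matrix.smul_one_eq_diagonal, ← Matrix.fromBlocks_one,
      Matrix.fromBlocks_smul, sub_eq_add_neg, Matrix.fromBlocks_neg, Matrix.fromBlocks_add]
    congr 1 <;> module
  rw [Set.mem_ofPred_eq, Matrix.eval_charpoly, hmat,
    Matrix.det_fromBlocks_smul_one_of_charpoly_eq_prod hl _ _ _ _ hxd, eval_prod]
  refine Finset.prod_congr rfl fun p _ => ?_
  simp only [eval_add, eval_sub, eval_mul, eval_pow, eval_X, eval_C]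
  ring

end

/-- Let `H` be a real symmetric `P × P` matrix with eigenvalues `λ₁, …, λ_P` (listed with
multiplicity, encoded by `H.charpoly = ∏ (X − λ_p)`), and let `α ≥ 0`, `β > 0`, `γ > 0`.
Then the `2P × 2P` block matrix
`M = [[(1 − γ(α − 1/β))I − γβH, −(γ/β)I], [−γ(α − 1/β)I, (1 − γ/β)I]]`
has characteristic polynomial
`∏_{p=1}^P (X² − (2 − γ(α + βλ_p))X + 1 − γ(α + βλ_p) + γ²λ_p)`. -/
theorem inna_jacobian_charpoly (P : ℕ) (H : Matrix (Fin P) (Fin P) ℝ) (hH : H.IsSymm)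
    (lam : Fin P → ℝ) (hlam : H.charpoly = ∏ p : Fin P, (X - C (lam p)))
    (α β γ : ℝ) (hα : 0 ≤ α) (hβ : 0 < β) (hγ : 0 < γ) :
    (Matrix.fromBlocks
        ((1 - γ * (α - 1 / β)) • (1 : Matrix (Fin P) (Fin P) ℝ) - (γ * β) • H)
        (-((γ / β) • (1 : Matrix (Fin P) (Fin P) ℝ)))
        (-((γ * (α - 1 / β)) • (1 : Matrix (Fin P) (Fin P) ℝ)))
        ((1 - γ / β) • (1 : Matrix (Fin P) (Fin P) ℝ))).charpoly =
      ∏ p : Fin P,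
        (X ^ 2 - C (2 - γ * (α + β * lam p)) * X
          + C (1 - γ * (α + β * lam p) + γ ^ 2 * lam p)) := by
  have hβ' : β ≠ 0 := hβ.ne'
  have key := Matrix.charpoly_fromBlocks_smul_one_of_charpoly_eq_prod hlam
    (1 - γ * (α - 1 / β)) (-(γ * β)) (-(γ / β)) (-(γ * (α - 1 / β))) (1 - γ / β)
  simp only [neg_smul, ← sub_eq_add_neg] at key
  rw [key]
  refine Finset.prod_congr rfl fun p _ => ?_
  congr 3
  · congr 1
    ring
  · field_simp
    ring
end

section
/- Let α ≥ 0, β > 0, γ > 0 and λ < 0. Then the quadratic X² − (2 − γ(α + βλ))X + (1 − γ(α + βλ) + γ²λ) has two distinct real roots σ₊ and σ₋ with σ₊ > 1 and σ₋ < 1. -/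
/-- Let `α ≥ 0`, `β > 0`, `γ > 0` and `λ < 0`.  Then the quadratic
`X² − (2 − γ(α + βλ))X + (1 − γ(α + βλ) + γ²λ)` has two distinct real roots
`σ₊` and `σ₋` with `σ₊ > 1` and `σ₋ < 1`. -/
theorem inna_saddle_roots (α β γ lam : ℝ)
    (hα : 0 ≤ α) (hβ : 0 < β) (hγ : 0 < γ) (hlam : lam < 0) :
    ∃ σp σm : ℝ, σp ≠ σm ∧ 1 < σp ∧ σm < 1 ∧
      ∀ x : ℝ,
        x ^ 2 - (2 - γ * (α + β * lam)) * x + (1 - γ * (α + β * lam) + γ ^ 2 * lam) = 0 ↔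
          x = σp ∨ x = σm := by
  set s := γ * (α + β * lam)
  have hc : γ ^ 2 * lam < 0 := mul_neg_of_pos_of_neg (by positivity) hlam
  set c := γ ^ 2 * lam
  obtain ⟨hneg, hpos⟩ : -√(s ^ 2 - 4 * c) < s ∧ s < √(s ^ 2 - 4 * c) :=
    abs_lt.mp (Real.lt_sqrt_of_sq_lt (by rw [sq_abs]; linarith))
  have hr : √(s ^ 2 - 4 * c) ^ 2 = s ^ 2 - 4 * c :=
    Real.sq_sqrt (by nlinarith [sq_nonneg s])
  set r := √(s ^ 2 - 4 * c)
  refine ⟨1 + (-s + r) / 2, 1 + (-s - r) / 2, ?_, by linarith, by linarith, fun x => ?_⟩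
  · intro h
    linarith
  · have hfactor : x ^ 2 - (2 - s) * x + (1 - s + c) =
        (x - (1 + (-s + r) / 2)) * (x - (1 + (-s - r) / 2)) := by
      linear_combination (1 / 4) * hr
    rw [hfactor, mul_eq_zero, sub_eq_zero, sub_eq_zero]
end

section
/- Let α > 0, β > 0, γ > 0 and λ > 0 with (α + βλ)² − 4λ ≤ 0. Then the two complex roots of the quadratic X² − (2 − γ(α + βλ))X + (1 − γ(α + βλ) + γ²λ) both have squared modulus equal to 1 − γ(α + βλ) + γ²λ, and this squared modulus is strictly less than 1 if and only if γ < β + α/λ. -/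
/-- A complex root of a real monic quadratic `X² - tX + p` with nonpositive discriminant has
squared modulus `p`. -/
theorem Complex.normSq_eq_of_quadratic_root {t p : ℝ} (h : t ^ 2 - 4 * p ≤ 0) {z : ℂ}
    (hz : z ^ 2 - (t : ℂ) * z + (p : ℂ) = 0) : Complex.normSq z = p := by
  have hre := congrArg Complex.re hz
  have him := congrArg Complex.im hz
  simp [pow_two] at hre him
  have ht : 2 * z.re - t = 0 := by
    by_cases hy : z.im = 0
    · rw [hy] at hre
      exact pow_eq_zero_iff two_ne_zero |>.mp (le_antisymm (by nlinarith) (sq_nonneg _))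
    · exact mul_right_cancel₀ hy (by linarith)
  rw [Complex.normSq_apply]
  linear_combination z.re * ht - hre

/-- Let `α > 0`, `β > 0`, `γ > 0` and `λ > 0` with `(α + βλ)² − 4λ ≤ 0`.  Then the two
complex roots of `X² − (2 − γ(α + βλ))X + (1 − γ(α + βλ) + γ²λ)` both have squared
modulus equal to `1 − γ(α + βλ) + γ²λ`, and this squared modulus is strictly less
than `1` if and only if `γ < β + α/λ`. -/
theorem inna_complex_roots_modulus (α β γ lam : ℝ)
    (hα : 0 < α) (hβ : 0 < β) (hγ : 0 < γ) (hlam : 0 < lam)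
    (hdisc : (α + β * lam) ^ 2 - 4 * lam ≤ 0) :
    (∀ z : ℂ,
        z ^ 2 - ((2 - γ * (α + β * lam) : ℝ) : ℂ) * z
            + ((1 - γ * (α + β * lam) + γ ^ 2 * lam : ℝ) : ℂ) = 0 →
          Complex.normSq z = 1 - γ * (α + β * lam) + γ ^ 2 * lam) ∧
      (1 - γ * (α + β * lam) + γ ^ 2 * lam < 1 ↔ γ < β + α / lam) := by
  refine ⟨fun z hz => Complex.normSq_eq_of_quadratic_root ?_ hz, ?_⟩
  · linarith [mul_nonpos_of_nonneg_of_nonpos (sq_nonneg γ) hdisc]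
  · have hfactor : 1 - γ * (α + β * lam) + γ ^ 2 * lam - 1
        = γ * lam * (γ - (β + α / lam)) := by
      field_simp
      ring
    rw [← sub_neg, hfactor, ← sub_neg (a := γ)]
    exact smul_neg_iff_of_pos_left (mul_pos hγ hlam)
end

section
/- Let α > 0 and β > 0 with αβ ≤ 1, and let L > 0 satisfy (α + βL)² ≥ 4L. Then for every x with 0 < x ≤ L and (α + βx)² ≥ 4x, one has α + βx + √((α + βx)² − 4x) ≤ max(2α, α + βL + √((α + βL)² − 4L)). -/
/-- Let `α > 0`, `β > 0` with `αβ ≤ 1`, and let `L > 0` satisfy `(α + βL)² ≥ 4L`.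
Then for every `x` with `0 < x ≤ L` and `(α + βx)² ≥ 4x`, one has
`α + βx + √((α + βx)² − 4x) ≤ max (2α) (α + βL + √((α + βL)² − 4L))`. -/
theorem upper_bound_outside_spiral_interval (α β L : ℝ)
    (hα : 0 < α) (hβ : 0 < β) (hαβ : α * β ≤ 1) (hL : 0 < L)
    (hdiscL : 4 * L ≤ (α + β * L) ^ 2) :
    ∀ x : ℝ, 0 < x → x ≤ L → 4 * x ≤ (α + β * x) ^ 2 →
      α + β * x + Real.sqrt ((α + β * x) ^ 2 - 4 * x) ≤
        max (2 * α) (α + β * L + Real.sqrt ((α + β * L) ^ 2 - 4 * L)) := by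
  intro x hx hxL hdisc
  rcases le_or_gt (α + β * x + √((α + β * x) ^ 2 - 4 * x)) (2 * α) with h | h
  · exact le_max_of_le_left h
  refine le_max_of_le_right ?_
  have hr := Real.sq_sqrt (sub_nonneg.2 hdisc)
  set s := α + β * x + √((α + β * x) ^ 2 - 4 * x) with hs
  have hroot : s * (s - 2 * α) = 2 * x * (β * s - 2) := by
    rw [hs]
    linear_combination hr
  have hs_pos : 0 < s := by linarith
  have hβs : 0 < β * s - 2 :=
    pos_of_mul_pos_right (hroot ▸ mul_pos hs_pos (sub_pos.2 h)) (by positivity)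
  have hsq : (s - (α + β * L)) ^ 2 ≤ (α + β * L) ^ 2 - 4 * L := by
    linarith [mul_le_mul_of_nonneg_right hxL hβs.le]
  linarith [Real.le_sqrt_of_sq_le hsq]
end
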